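/- In any execution of Algorithm A_k, if process i exits its for-loop via a break (i.e., in iteration r_i it reads from R_{3−i} a value new equal to its current prec) and the other process 3−i reaches iteration r_i of its for-loop, then process 3−i does not exit its for-loop via a break in iteration r_i. -/

import Mathlib

/-!
Operational semantics of the two-process 1-bit-register approximate-agreement
protocol `A_k` (Algorithm 1 of the paper).

The two processes are indexed by `Fin 2`.  Shared memory consists of two 1-bit
registers `R 0, R 1` (initialized to `false`, i.e. `0`; only process `i` writes
`R i`) and two write-once input registers `I 0, I 1` (initialized to `⊥ = none`).
Each read or write of a single register is one atomic step.  An execution is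
determined by the inputs `x : Fin 2 → Bool` together with a schedule
`sched : ℕ → Fin 2` telling which process takes the next step (a step of a
process that has already decided is a no-op; a process crashes by being
scheduled only finitely often).
-/

namespace AlgoAk

/-- The other process. -/
def other (i : Fin 2) : Fin 2 := if i = 0 then 1 else 0

/-- The value (0 or 1) as a rational. -/
def bq (b : Bool) : ℚ := if b then 1 else 0

/-- Program counter of a process:
`start` = about to write its input to its input register;
`loopW` = about to perform the write of the current for-loop iteration;
`loopR` = about to perform the read of the current for-loop iteration;
`readMine` = left the for-loop, about to read its own input register;
`readOther` = about to read the other input register (and then decide);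
`done` = has decided. -/
inductive PC where
  | start | loopW | loopR | readMine | readOther | done
deriving DecidableEq

/-- Local state of a process: program counter, loop variable `r`, local
variables `prec` and `new`, the value read from the other input register,
and the output (once decided). -/
structure PState where
  pc : PC
  r : ℕ
  prec : Bool
  new : Bool
  xother : Option Bool
  out : Option ℚ

/-- Global configuration: local states, the two 1-bit registers, and the two
write-once input registers. -/
structure Config where
  p : Fin 2 → PState
  R : Fin 2 → Bool
  I : Fin 2 → Option Bool

/-- Initial local state. -/
def initP : PState := ⟨PC.start, 1, false, false, none, none⟩

/-- Initial configuration. -/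
def initC : Config := ⟨fun _ => initP, fun _ => false, fun _ => none⟩

/-- Update the local state of process `i`. -/
def updP (c : Config) (i : Fin 2) (s : PState) : Config :=
  { c with p := Function.update c.p i s }

/-- The decision function of the protocol, computed from the process' own input
`xme`, the value `xother` read from the other input register, and the values
`r` and `new` of the local variables when the for-loop was left. -/
def decideVal (k : ℕ) (xme : Bool) (xother : Option Bool) (r : ℕ) (new : Bool) : ℚ :=
  match xother with
  | none => bq xme
  | some xo =>
    if xme = xo then bq xme
    else if r = k ∧ new = decide (k % 2 = 1) then
      -- normal termination after k iterations
      let xwho := if r % 2 = 0 then xme else xo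
      (bq xwho + (k : ℚ)) / (2 * (k : ℚ) + 1)
    else
      -- left the loop via a break at iteration r
      let xwho := if r % 2 = 0 then xo else xme
      bq xwho + ((-1 : ℚ) ^ (if xwho then 1 else 0) * ((r : ℚ) - 1)) / (2 * (k : ℚ) + 1)

/-- One atomic step of process `i` in configuration `c`. -/
def step (k : ℕ) (x : Fin 2 → Bool) (c : Config) (i : Fin 2) : Config :=
  let s := c.p i
  match s.pc with
  | PC.start =>
      let c' := updP c i { s with pc := PC.loopW }
      { c' with I := Function.update c'.I i (some (x i)) }
  | PC.loopW =>
      let c' := updP c i { s with pc := PC.loopR }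
      { c' with R := Function.update c'.R i (decide (s.r % 2 = 1)) }
  | PC.loopR =>
      let nv := c.R (other i)
      if nv ≠ s.prec then
        if s.r < k then
          updP c i { s with pc := PC.loopW, r := s.r + 1, prec := nv, new := nv }
        else
          updP c i { s with pc := PC.readMine, prec := nv, new := nv }
      else
        updP c i { s with pc := PC.readMine, new := nv }
  | PC.readMine =>
      updP c i { s with pc := PC.readOther }
  | PC.readOther =>
      let xo := c.I (other i)
      updP c i { s with pc := PC.done, xother := xo,
                        out := some (decideVal k (x i) xo s.r s.new) }
  | PC.done => c

/-- The configuration after `n` steps of the execution of `A_k` with inputs `x`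
and schedule `sched`. -/
def run (k : ℕ) (x : Fin 2 → Bool) (sched : ℕ → Fin 2) : ℕ → Config
  | 0 => initC
  | n + 1 => step k x (run k x sched n) (sched n)

end AlgoAk

namespace AlgoAk

/-- Process `i` exits its for-loop via a break at iteration `r`: at some time `n`
it is scheduled while at the read of iteration `r` of its loop, and the value it
reads from the other process' register equals its current `prec`. -/
def breaksAt (k : ℕ) (x : Fin 2 → Bool) (sched : ℕ → Fin 2) (i : Fin 2) (r : ℕ) : Prop :=
  ∃ n : ℕ, sched n = i ∧ ((run k x sched n).p i).pc = PC.loopR ∧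
    ((run k x sched n).p i).r = r ∧
    (run k x sched n).R (other i) = ((run k x sched n).p i).prec

/-- Process `i` reaches iteration `r` of its for-loop (it is about to perform
the write of iteration `r`). -/
def reaches (k : ℕ) (x : Fin 2 → Bool) (sched : ℕ → Fin 2) (i : Fin 2) (r : ℕ) : Prop :=
  ∃ n : ℕ, ((run k x sched n).p i).pc = PC.loopW ∧ ((run k x sched n).p i).r = r

end AlgoAk

namespace AlgoAk

theorem other_ne (i : Fin 2) : other i ≠ i := by
  revert i; decide

theorem other_other (i : Fin 2) : other (other i) = i := by
  revert i; decide

/-- The process has left its for-loop. -/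
def PC.isPostLoop : PC → Bool
  | readMine | readOther | done => true
  | _ => false

/-- While a process has not left its loop, `prec` is the parity of the previous iteration, and
between the write and the read of an iteration its register holds the parity of that iteration. -/
def ParityInvariant (c : Config) (i : Fin 2) : Prop :=
  ((c.p i).pc.isPostLoop = false → (c.p i).prec = decide ((c.p i).r % 2 = 0)) ∧
    ((c.p i).pc = PC.loopR → c.R i = decide ((c.p i).r % 2 = 1))

theorem step_of_ne (k : ℕ) (x : Fin 2 → Bool) (c : Config) {i j : Fin 2} (h : i ≠ j) :
    (step k x c j).p i = c.p i ∧ (step k x c j).R i = c.R i := by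
  unfold step updP
  cases hpc : (c.p j).pc
  case loopR => simp only [hpc]; split_ifs <;> simp [h]
  all_goals simp [hpc, h]

theorem decide_succ_mod_two_eq_zero {b : Bool} {r : ℕ} (h : b ≠ decide (r % 2 = 0)) :
    b = decide ((r + 1) % 2 = 0) := by
  rcases Nat.mod_two_eq_zero_or_one r with hr | hr <;> simp_all [Nat.add_mod]

theorem ParityInvariant.step {k : ℕ} {x : Fin 2 → Bool} {c : Config} {i : Fin 2}
    (h : ParityInvariant c i) (j : Fin 2) : ParityInvariant (step k x c j) i := by
  by_cases hij : i = j
  · subst hij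
    obtain ⟨hprec, -⟩ := h
    unfold ParityInvariant AlgoAk.step updP
    cases hpc : (c.p i).pc
    case loopR =>
      rw [hpc] at hprec
      have hp := hprec rfl
      simp only [hpc]
      split_ifs with hnew
      · rw [hp] at hnew
        simpa [PC.isPostLoop] using decide_succ_mod_two_eq_zero hnew
      all_goals simp [PC.isPostLoop]
    all_goals simp_all [PC.isPostLoop]
  · obtain ⟨hp, hR⟩ := step_of_ne k x c hij
    unfold ParityInvariant
    rwa [hp, hR]

theorem parityInvariant_run (k : ℕ) (x : Fin 2 → Bool) (sched : ℕ → Fin 2) (i : Fin 2) (n : ℕ) :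
    ParityInvariant (run k x sched n) i := by
  induction n with
  | zero => simp [ParityInvariant, run, initC, initP]
  | succ n ih => exact ih.step _

theorem isPostLoop_step {k : ℕ} {x : Fin 2 → Bool} {c : Config} {i : Fin 2}
    (h : (c.p i).pc.isPostLoop = true) (j : Fin 2) :
    ((step k x c j).p i).pc.isPostLoop = true ∧ (step k x c j).R i = c.R i := by
  by_cases hij : i = j
  · subst hij
    unfold step updP
    cases hpc : (c.p i).pc <;> simp_all [PC.isPostLoop]
  · obtain ⟨hp, hR⟩ := step_of_ne k x c hij
    rw [hp, hR]
    exact ⟨h, rfl⟩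

/-- A process that has left its loop never writes to its register again. -/
theorem isPostLoop_run {k : ℕ} {x : Fin 2 → Bool} {sched : ℕ → Fin 2} {i : Fin 2} {n m : ℕ}
    (h : ((run k x sched n).p i).pc.isPostLoop = true) (hnm : n ≤ m) :
    ((run k x sched m).p i).pc.isPostLoop = true ∧
      (run k x sched m).R i = (run k x sched n).R i := by
  induction m, hnm using Nat.le_induction with
  | base => exact ⟨h, rfl⟩
  | succ m _ ih =>
    obtain ⟨hpc, hR⟩ := isPostLoop_step (k := k) (x := x) ih.1 (sched m)
    exact ⟨hpc, hR.trans ih.2⟩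

/-- Reading the current `prec` leaves the loop without changing the registers. -/
theorem step_of_break {k : ℕ} {x : Fin 2 → Bool} {c : Config} {i : Fin 2}
    (hpc : (c.p i).pc = PC.loopR) (hread : c.R (other i) = (c.p i).prec) :
    ((step k x c i).p i).pc.isPostLoop = true ∧ (step k x c i).R i = c.R i := by
  simp [step, updP, hpc, hread, PC.isPostLoop]

/-- After process `i` breaks at iteration `r`, the other process cannot break at iteration `r`. -/
theorem not_break_of_earlier_break {k : ℕ} {x : Fin 2 → Bool} {sched : ℕ → Fin 2} {i : Fin 2}
    {n m : ℕ} (hnm : n < m) (hsched : sched n = i)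
    (hpc : ((run k x sched n).p i).pc = PC.loopR)
    (hread : (run k x sched n).R (other i) = ((run k x sched n).p i).prec)
    (hpc' : ((run k x sched m).p (other i)).pc = PC.loopR)
    (hr : ((run k x sched m).p (other i)).r = ((run k x sched n).p i).r) :
    (run k x sched m).R i ≠ ((run k x sched m).p (other i)).prec := by
  obtain ⟨hpost, hR⟩ := step_of_break (k := k) (x := x) hpc hread
  have hrun : run k x sched (n + 1) = step k x (run k x sched n) i := by rw [run, hsched]
  rw [← hrun] at hpost hR
  have hRm := (isPostLoop_run hpost hnm).2
  have hwritten := (parityInvariant_run k x sched i n).2 hpc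
  have hprec := (parityInvariant_run k x sched (other i) m).1 (by rw [hpc']; rfl)
  rw [hRm, hR, hwritten, hprec, hr]
  rcases Nat.mod_two_eq_zero_or_one ((run k x sched n).p i).r with h | h <;> simp [h]

end AlgoAk

open AlgoAk in
/-- Lemma 8: if process `i` exits its for-loop via a break in iteration `r`, and
the other process reaches iteration `r`, then the other process does not exit its
for-loop via a break in iteration `r`. -/
theorem no_two_breaks_same_iteration (k : ℕ) (hk : 1 ≤ k) (x : Fin 2 → Bool)
    (sched : ℕ → Fin 2) (i : Fin 2) (r : ℕ)
    (hbrk : breaksAt k x sched i r)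
    (hreach : reaches k x sched (other i) r) :
    ¬ breaksAt k x sched (other i) r := by
  rintro ⟨m, hm, hpcm, hrm, hreadm⟩
  obtain ⟨n, hn, hpcn, hrn, hreadn⟩ := hbrk
  rcases lt_trichotomy n m with hlt | rfl | hlt
  · rw [other_other] at hreadm
    exact not_break_of_earlier_break hlt hn hpcn hreadn hpcm (hrm.trans hrn.symm) hreadm
  · exact other_ne i (hm.symm.trans hn)
  · refine not_break_of_earlier_break hlt hm hpcm hreadm ?_ ?_ ?_ <;> rw [other_other]
    exacts [hpcn, hrn.trans hrm.symm, hreadn]
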